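/- arXiv:2510.24200 — 2 statements merged into one kernel-verified Lean document; each statement's English description precedes it below -/
import Mathlib

section
/- Let G ∈ ℝ^{m×b}, L ∈ ℝ^{m×b}, and let Q ∈ ℝ^{b×b} be invertible with G = L·Q. Let I be a set of b−1 row indices of G such that the i-th column of the row submatrix G_I ∈ ℝ^{(b−1)×b} is zero for some i ∈ {1,…,b}, and such that the corresponding row submatrix L_I ∈ ℝ^{(b−1)×b} of L has rank b−1. Then the kernel of L_I is exactly the one-dimensional subspace spanned by the i-th column q_i of Q, i.e. Span(q_i) = ker(L_I). -/
open Matrix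

/-- If `G = L * Q` with `Q` invertible, the `i`-th column of the row submatrix `G_I` is
zero, and the corresponding row submatrix `L_I` of `L` has rank `b - 1`, then the kernel
of `L_I` is exactly the span of the `i`-th column `q_i` of `Q`. -/
theorem kernel_of_submatrix_eq_span_column (m b : ℕ)
    (G L : Matrix (Fin m) (Fin b) ℝ)
    (Q : Matrix (Fin b) (Fin b) ℝ) (hQ : IsUnit Q) (hG : G = L * Q)
    (r : Fin (b - 1) → Fin m) (hr : Function.Injective r)
    (i : Fin b) (hcol : ∀ k : Fin (b - 1), G.submatrix r id k i = 0)
    (hrank : (L.submatrix r id).rank = b - 1) :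
    Submodule.span ℝ {(fun j => Q j i : Fin b → ℝ)} =
      LinearMap.ker (L.submatrix r id).mulVecLin := by
  have hq : (fun j => Q j i : Fin b → ℝ) ≠ 0 := fun h =>
    (Matrix.linearIndependent_cols_of_isUnit hQ).ne_zero i h
  have hrank_nullity := (L.submatrix r id).mulVecLin.finrank_range_add_finrank_ker
  rw [← Matrix.rank, hrank, Module.finrank_fin_fun] at hrank_nullity
  refine Submodule.eq_of_le_of_finrank_eq ?_ ?_
  · rw [Submodule.span_singleton_le_iff_mem, LinearMap.mem_ker]
    ext k
    simpa [hG, Matrix.mul_apply, Matrix.mulVec, dotProduct] using hcol k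
  · rw [finrank_span_singleton hq]
    have := i.pos
    lia
end

section
/- Let L ∈ ℝ^{m×b}, let L† ∈ ℝ^{b×m} be any left inverse of L (i.e. L†·L = I_b), let Q̄ ∈ ℝ^{b×b} be invertible, and let s ∈ ℝ^b be such that G := L·Q̄·diag(s) ∈ ℝ^{m×b}. Let g_b := G·𝟙 ∈ ℝ^m be the vector of row sums of G (the bias gradient ∂ℒ/∂b). Then Q̄⁻¹·L†·g_b = s; that is, the unknown per-column scaling factors s_1,…,s_b of a candidate disaggregation matrix Q̄ are recovered exactly by the formula (s_1,…,s_b)ᵀ = Q̄⁻¹·L†·(∂ℒ/∂b). -/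
open Matrix

/-- Scale fixing via the bias gradient: if `G = L * Q̄ * diag s` and `g_b = G *ᵥ 𝟙` is the
bias gradient (vector of row sums of `G`), then `Q̄⁻¹ * L† * g_b = s` for any left
inverse `L†` of `L`. -/
theorem scale_recovery_from_bias_gradient (m b : ℕ)
    (L : Matrix (Fin m) (Fin b) ℝ)
    (Ldag : Matrix (Fin b) (Fin m) ℝ) (hLdag : Ldag * L = 1)
    (Qbar : Matrix (Fin b) (Fin b) ℝ) (hQbar : IsUnit Qbar)
    (s : Fin b → ℝ) (G : Matrix (Fin m) (Fin b) ℝ)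
    (hG : G = L * Qbar * Matrix.diagonal s) :
    (Qbar⁻¹ * Ldag).mulVec (G.mulVec 1) = s := by
  have hdet : IsUnit Qbar.det := (Matrix.isUnit_iff_isUnit_det Qbar).1 hQbar
  have hmul : Qbar⁻¹ * Ldag * G = Matrix.diagonal s := by
    calc Qbar⁻¹ * Ldag * G = Qbar⁻¹ * (Ldag * L) * Qbar * Matrix.diagonal s := by
          simp only [hG, Matrix.mul_assoc]
      _ = Matrix.diagonal s := by
          rw [hLdag, Matrix.mul_one, Matrix.nonsing_inv_mul Qbar hdet, Matrix.one_mul]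
  rw [Matrix.mulVec_mulVec, hmul]
  ext i
  simp [Matrix.mulVec_diagonal]
end
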